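/- Let Λ ⊆ ℝ^N be a non-periodic Delone set satisfying positivity of weights (PW) and uniformity of return words (U). Then Λ is linearly repetitive (LR); more precisely, there is a constant K such that r_cov(L_P) ≤ K · r(P) for every ball pattern P on Λ with r(P) ≥ 3. -/

import Mathlib

open Filter MeasureTheory Bornology
open scoped ENNReal

noncomputable section

/-- Euclidean space `ℝ^N`. -/
abbrev Euc (N : ℕ) := EuclideanSpace ℝ (Fin N)

/-- The packing radius of a set: half of the infimum of distances between
distinct points (`⊤` if no such pair exists). -/
def rPack {N : ℕ} (Λ : Set (Euc N)) : ℝ≥0∞ :=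
  ⨅ (x ∈ Λ) (y ∈ Λ) (_ : x ≠ y), edist x y / 2

/-- The covering radius of a set: the supremum over all points of the space of
the distance to the set. -/
def rCov {N : ℕ} (Λ : Set (Euc N)) : ℝ≥0∞ :=
  ⨆ p : Euc N, EMetric.infEdist p Λ

/-- A set is uniformly discrete if its packing radius is positive. -/
def UniformlyDiscrete {N : ℕ} (Λ : Set (Euc N)) : Prop := 0 < rPack Λ

/-- A set is relatively dense if its covering radius is finite. -/
def RelativelyDense {N : ℕ} (Λ : Set (Euc N)) : Prop := rCov Λ < ⊤

/-- A Delone set is a uniformly discrete and relatively dense set. -/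
def IsDelone {N : ℕ} (Λ : Set (Euc N)) : Prop :=
  UniformlyDiscrete Λ ∧ RelativelyDense Λ

/-- Λ is non-periodic if no nonzero translate of Λ equals Λ. -/
def NonPeriodic {N : ℕ} (Λ : Set (Euc N)) : Prop :=
  ∀ t : Euc N, t ≠ 0 → (fun p => p - t) '' Λ ≠ Λ

/-- The patch of the ball pattern `(x, R)`: `(Λ - x) ∩ B_R`. -/
def patch {N : ℕ} (Λ : Set (Euc N)) (x : Euc N) (R : ℝ) : Set (Euc N) :=
  ((fun y => y - x) '' Λ) ∩ Metric.closedBall 0 R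

/-- The locater set of the ball pattern `(x, R)`: the set of points of Λ whose
`R`-patch agrees with that of `x`. -/
def locSet {N : ℕ} (Λ : Set (Euc N)) (x : Euc N) (R : ℝ) : Set (Euc N) :=
  {y ∈ Λ | patch Λ y R = patch Λ x R}

/-- Λ is repetitive if the locater set of every ball pattern is relatively dense. -/
def Repetitive {N : ℕ} (Λ : Set (Euc N)) : Prop :=
  ∀ x ∈ Λ, ∀ R : ℝ, 0 < R → RelativelyDense (locSet Λ x R)

/-- `L_P(Q)`: the points of the locater set of `(x,R)` whose `R`-ball lies inside `Q`. -/
def locIn {N : ℕ} (Λ : Set (Euc N)) (x : Euc N) (R : ℝ) (Q : Set (Euc N)) :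
    Set (Euc N) :=
  {y ∈ locSet Λ x R | Metric.closedBall y R ⊆ Q}

/-- `♯_P Q`: the number of copies of the ball pattern `P = (x,R)` in `Q`. -/
def countP {N : ℕ} (Λ : Set (Euc N)) (x : Euc N) (R : ℝ) (Q : Set (Euc N)) : ℕ :=
  (locIn Λ x R Q).ncard

/-- `♯'_P Q`: the maximal number of completely disjoint copies of `P = (x,R)` in `Q`. -/
def countP' {N : ℕ} (Λ : Set (Euc N)) (x : Euc N) (R : ℝ) (Q : Set (Euc N)) : ℕ :=
  sSup {n : ℕ | ∃ A : Finset (Euc N), ↑A ⊆ locIn Λ x R Q ∧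
    (∀ u ∈ A, ∀ v ∈ A, u ≠ v → 2 * R < dist u v) ∧ A.card = n}

/-- The cube with corner `a` and sidelength `s`. -/
def cube {N : ℕ} (a : Euc N) (s : ℝ) : Set (Euc N) :=
  {p | ∀ i, a i ≤ p i ∧ p i ≤ a i + s}

/-- The filter describing cubes `C` with `|C| → ∞`: arbitrary corner, sidelength
tending to infinity. -/
def cubeFilter (N : ℕ) : Filter (Euc N × ℝ) := (⊤ : Filter (Euc N)) ×ˢ atTop

/-- The Lebesgue measure `|B_R|` of a closed ball of radius `R` in `ℝ^N`. -/
def ballVol (N : ℕ) (R : ℝ) : ℝ := (volume (Metric.closedBall (0 : Euc N) R)).toReal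

/-- The lower density `ν(P)` of the ball pattern `P = (x,R)`:
`liminf_{|C|→∞} ♯_P C · |B_R| / |C|` over cubes `C`. -/
def nu {N : ℕ} (Λ : Set (Euc N)) (x : Euc N) (R : ℝ) : ℝ :=
  liminf (fun cs : Euc N × ℝ =>
    (countP Λ x R (cube cs.1 cs.2) : ℝ) * ballVol N R / cs.2 ^ N) (cubeFilter N)

/-- The lower reduced density `ν'(P)` of the ball pattern `P = (x,R)`:
`liminf_{|C|→∞} ♯'_P C · |B_R| / |C|` over cubes `C`. -/
def nu' {N : ℕ} (Λ : Set (Euc N)) (x : Euc N) (R : ℝ) : ℝ :=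
  liminf (fun cs : Euc N × ℝ =>
    (countP' Λ x R (cube cs.1 cs.2) : ℝ) * ballVol N R / cs.2 ^ N) (cubeFilter N)

/-- `w = inf {ν(P) : r(P) ≥ 1}`. -/
def wPW {N : ℕ} (Λ : Set (Euc N)) : ℝ :=
  sInf {v | ∃ x ∈ Λ, ∃ R : ℝ, 1 ≤ R ∧ v = nu Λ x R}

/-- `w' = inf {ν'(P) : r(P) ≥ 1}`. -/
def wPQ {N : ℕ} (Λ : Set (Euc N)) : ℝ :=
  sInf {v | ∃ x ∈ Λ, ∃ R : ℝ, 1 ≤ R ∧ v = nu' Λ x R}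

/-- Positivity of weights (PW). -/
def PW {N : ℕ} (Λ : Set (Euc N)) : Prop := 0 < wPW Λ

/-- Positivity of quasiweights (PQ). -/
def PQ {N : ℕ} (Λ : Set (Euc N)) : Prop := 0 < wPQ Λ

/-- A function on (bounded) subsets of `ℝ^N` is subadditive if
`F(Q₁ ∪ Q₂) ≤ F(Q₁) + F(Q₂)` for disjoint bounded `Q₁, Q₂`. -/
def SubadditiveFn {N : ℕ} (F : Set (Euc N) → ℝ) : Prop :=
  ∀ Q₁ Q₂ : Set (Euc N), IsBounded Q₁ → IsBounded Q₂ → Disjoint Q₁ Q₂ →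
    F (Q₁ ∪ Q₂) ≤ F Q₁ + F Q₂

/-- A function on (bounded) subsets is Λ-invariant if `F(Q) = F(t + Q)` whenever
`t + (Q ∩ Λ) = (t + Q) ∩ Λ`. -/
def InvariantFn {N : ℕ} (Λ : Set (Euc N)) (F : Set (Euc N) → ℝ) : Prop :=
  ∀ (t : Euc N) (Q : Set (Euc N)), IsBounded Q →
    (fun p => t + p) '' (Q ∩ Λ) = ((fun p => t + p) '' Q) ∩ Λ →
    F Q = F ((fun p => t + p) '' Q)

/-- Λ satisfies the subadditive ergodic theorem (SET) if for every subadditive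
Λ-invariant function `F` the limit `lim_{|C|→∞} F(C)/|C|` over cubes exists. -/
def SET {N : ℕ} (Λ : Set (Euc N)) : Prop :=
  ∀ F : Set (Euc N) → ℝ, SubadditiveFn F → InvariantFn Λ F →
    ∃ L : ℝ, Tendsto (fun cs : Euc N × ℝ => F (cube cs.1 cs.2) / cs.2 ^ N)
      (cubeFilter N) (nhds L)

/-- Linear repetitivity (LR): `sup {r_cov(L_P)/r(P) : r(P) ≥ 1} < ∞`. -/
def LR {N : ℕ} (Λ : Set (Euc N)) : Prop :=
  (⨆ (x ∈ Λ) (R : ℝ) (_ : 1 ≤ R), rCov (locSet Λ x R) / ENNReal.ofReal R) < ⊤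

/-- The repulsion property (RP): `inf {r_pack(L_P)/r(P) : P a ball pattern} > 0`. -/
def RP {N : ℕ} (Λ : Set (Euc N)) : Prop :=
  0 < ⨅ (x ∈ Λ) (R : ℝ) (_ : 0 < R), rPack (locSet Λ x R) / ENNReal.ofReal R

/-- The Voronoi cell of `x` with respect to `Γ`. -/
def voronoiCell {N : ℕ} (Γ : Set (Euc N)) (x : Euc N) : Set (Euc N) :=
  {p | ∀ y ∈ Γ, dist p x ≤ dist p y}

/-- The inner radius of a set `V` around `x`. -/
def rIn {N : ℕ} (x : Euc N) (V : Set (Euc N)) : ℝ≥0∞ :=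
  sSup {R : ℝ≥0∞ | EMetric.closedBall x R ⊆ V}

/-- The outer radius of a set `V` around `x`. -/
def rOut {N : ℕ} (x : Euc N) (V : Set (Euc N)) : ℝ≥0∞ :=
  sInf {R : ℝ≥0∞ | V ⊆ EMetric.closedBall x R}

/-- The distortion `λ(V) = r_out(V)/r_in(V)` of a set `V` around `x`. -/
def distortion {N : ℕ} (x : Euc N) (V : Set (Euc N)) : ℝ≥0∞ := rOut x V / rIn x V

/-- The distortion of a discrete set: the supremum of the distortions of its
Voronoi cells. -/
def setDistortion {N : ℕ} (Γ : Set (Euc N)) : ℝ≥0∞ :=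
  ⨆ x ∈ Γ, distortion x (voronoiCell Γ x)

/-- Uniformity of return words (U): the distortions of all locater sets of Λ are
uniformly bounded. -/
def URW {N : ℕ} (Λ : Set (Euc N)) : Prop :=
  (⨆ (x ∈ Λ) (R : ℝ) (_ : 0 < R), setDistortion (locSet Λ x R)) < ⊤

end

/-- The distance from `z` to the nearest other point of `L`. -/
noncomputable def nearestDist {N : ℕ} (L : Set (Euc N)) (z : Euc N) : ℝ :=
  Metric.infDist z (L \ {z})

lemma nearestDist_le_dist {N : ℕ} {L : Set (Euc N)} {u z : Euc N} (hu : u ∈ L) (h : u ≠ z) :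
    nearestDist L z ≤ dist z u :=
  Metric.infDist_le_dist_of_mem ⟨hu, h⟩

lemma nearestDist_nonneg {N : ℕ} (L : Set (Euc N)) (z : Euc N) : 0 ≤ nearestDist L z :=
  Metric.infDist_nonneg

/-- Every subset of a uniformly discrete set is closed. -/
lemma UniformlyDiscrete.isClosed_of_subset {N : ℕ} {Λ A : Set (Euc N)}
    (h : UniformlyDiscrete Λ) (hA : A ⊆ Λ) : IsClosed A := by
  obtain ⟨ε, hε, hlt⟩ := ENNReal.lt_iff_exists_nnreal_btwn.1 h
  have hε0 : (0 : ℝ) < ε := by exact_mod_cast hε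
  refine Metric.isClosed_of_pairwise_le_dist hε0 fun x hx y hy hxy => ?_
  have h1 : rPack Λ ≤ edist x y / 2 :=
    iInf_le_of_le x <| iInf_le_of_le (hA hx) <| iInf_le_of_le y <| iInf_le_of_le (hA hy) <|
      iInf_le _ hxy
  have h2 : (ε : ℝ≥0∞) ≤ edist x y := (hlt.le.trans h1).trans ENNReal.half_le_self
  rw [edist_nndist] at h2
  change (ε : ℝ) ≤ dist x y
  rw [dist_nndist]
  exact_mod_cast h2

lemma exists_dist_eq_nearestDist {N : ℕ} {L : Set (Euc N)} (hL : ∀ A ⊆ L, IsClosed A)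
    (hnt : L.Nontrivial) (z : Euc N) :
    ∃ u ∈ L, u ≠ z ∧ dist z u = nearestDist L z := by
  have hne : (L \ {z}).Nonempty := by
    obtain ⟨u, hu, huz⟩ := hnt.exists_ne z
    exact ⟨u, hu, huz⟩
  obtain ⟨u, hu, h⟩ := (hL _ Set.sdiff_subset).exists_infDist_eq_dist hne z
  exact ⟨u, hu.1, hu.2, h.symm⟩

lemma rIn_voronoiCell_le {N : ℕ} {L : Set (Euc N)} (hL : ∀ A ⊆ L, IsClosed A)
    (hnt : L.Nontrivial) (y : Euc N) :
    rIn y (voronoiCell L y) ≤ ENNReal.ofReal (nearestDist L y) := by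
  obtain ⟨u, hu, huy, hd⟩ := exists_dist_eq_nearestDist hL hnt y
  refine sSup_le fun r hr => ?_
  by_contra! hlt
  have hmem : u ∈ voronoiCell L y := hr <| by
    rw [← hd, ← edist_dist, edist_comm] at hlt
    exact hlt.le
  have := hmem u hu
  rw [dist_self] at this
  exact huy (dist_le_zero.1 this)

/-- A bound on the distortion bounds the Voronoi cells by nearest-neighbour distances. -/
lemma dist_le_of_mem_voronoiCell {N : ℕ} {L : Set (Euc N)} (hL : ∀ A ⊆ L, IsClosed A)
    (hnt : L.Nontrivial) {D : ℝ} (hD : 0 < D) (h : setDistortion L ≤ ENNReal.ofReal D)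
    {y q : Euc N} (hy : y ∈ L) (hq : q ∈ voronoiCell L y) :
    dist q y ≤ D * nearestDist L y := by
  have h1 : rOut y (voronoiCell L y) / rIn y (voronoiCell L y) ≤ ENNReal.ofReal D :=
    (le_iSup₂ (f := fun x (_ : x ∈ L) => distortion x (voronoiCell L x)) y hy).trans h
  rw [ENNReal.div_le_iff_le_mul (Or.inr ENNReal.ofReal_ne_top)
    (Or.inr (ENNReal.ofReal_pos.2 hD).ne')] at h1
  have h2 : edist q y ≤ rOut y (voronoiCell L y) := le_sInf fun r hr => hr hq
  have h3 : edist q y ≤ ENNReal.ofReal (D * nearestDist L y) := by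
    rw [ENNReal.ofReal_mul hD.le]
    exact (h2.trans h1).trans (by gcongr; exact rIn_voronoiCell_le hL hnt y)
  rw [edist_dist] at h3
  exact (ENNReal.ofReal_le_ofReal_iff (mul_nonneg hD.le (nearestDist_nonneg _ _))).1 h3

/-- Nearest-neighbour distances do not jump by more than a factor `2 * D`. -/
lemma exists_nearestDist_between {N : ℕ} {L : Set (Euc N)} (hL : ∀ A ⊆ L, IsClosed A) {D : ℝ}
    (hvor : ∀ y ∈ L, ∀ q ∈ voronoiCell L y, dist q y ≤ D * nearestDist L y) (hD : 1 ≤ D)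
    {a : ℝ} {y₀ y₁ : Euc N} (hy₀ : y₀ ∈ L) (hy₁ : y₁ ∈ L)
    (h₀ : nearestDist L y₀ ≤ a) (h₁ : 2 * D * a < nearestDist L y₁) :
    ∃ z ∈ L, a < nearestDist L z ∧ nearestDist L z ≤ 2 * D * a := by
  by_contra! hcon
  set A := {y ∈ L | nearestDist L y ≤ a}
  set B := {y ∈ L | 2 * D * a < nearestDist L y}
  have hAne : A.Nonempty := ⟨y₀, hy₀, h₀⟩
  have hBne : B.Nonempty := ⟨y₁, hy₁, h₁⟩
  have hAB : ∀ y ∈ L, y ∈ A ∨ y ∈ B := fun y hy => by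
    rcases le_or_gt (nearestDist L y) a with h | h
    · exact Or.inl ⟨hy, h⟩
    · exact Or.inr ⟨hy, hcon y hy h⟩
  obtain ⟨q, hq⟩ : (0 : ℝ) ∈ Set.range fun q => Metric.infDist q A - Metric.infDist q B := by
    refine mem_range_of_exists_le_of_exists_ge
      ((Metric.continuous_infDist_pt A).sub (Metric.continuous_infDist_pt B)) ⟨y₀, ?_⟩ ⟨y₁, ?_⟩
    · have : Metric.infDist y₀ A = 0 := Metric.infDist_zero_of_mem ⟨hy₀, h₀⟩
      simp [this, Metric.infDist_nonneg]
    · have : Metric.infDist y₁ B = 0 := Metric.infDist_zero_of_mem ⟨hy₁, h₁⟩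
      simp [this, Metric.infDist_nonneg]
  have hq : Metric.infDist q A = Metric.infDist q B := sub_eq_zero.1 hq
  obtain ⟨y, hyA, hy⟩ := (hL A (Set.sep_subset _ _)).exists_infDist_eq_dist hAne q
  obtain ⟨y', hyB, hy'⟩ := (hL B (Set.sep_subset _ _)).exists_infDist_eq_dist hBne q
  have hcell : q ∈ voronoiCell L y := fun v hv => by
    rcases hAB v hv with h | h
    · rw [← hy]; exact Metric.infDist_le_dist_of_mem h
    · rw [← hy, hq]; exact Metric.infDist_le_dist_of_mem h
  have hle := hvor y hyA.1 q hcell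
  have hDa : D * nearestDist L y ≤ D * a := mul_le_mul_of_nonneg_left hyA.2 (by linarith)
  have hdist : dist y' y ≤ 2 * (D * a) := by
    have := dist_triangle_left y' y q
    linarith
  have ha : 0 ≤ a := (nearestDist_nonneg _ _).trans h₀
  have hne : y ≠ y' := by
    rintro rfl
    have h3 := hyB.2
    have h4 := hyA.2
    nlinarith
  have := nearestDist_le_dist hyA.1 hne
  have := hyB.2
  linarith

lemma mem_patch_iff {N : ℕ} {Λ : Set (Euc N)} {x v : Euc N} {R : ℝ} :
    v ∈ patch Λ x R ↔ v + x ∈ Λ ∧ ‖v‖ ≤ R := by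
  simp only [patch, Set.mem_inter_iff, Set.mem_image, mem_closedBall_zero_iff]
  refine and_congr_left fun _ => ⟨?_, fun h => ⟨v + x, h, by simp⟩⟩
  rintro ⟨y, hy, rfl⟩
  simpa using hy

/-- Copies of the pattern `(x, R)` inside a ball of radius `T` are transported between points with
the same `T`-patch. -/
lemma translate_mem_locSet {N : ℕ} {Λ : Set (Euc N)} {x z z' u : Euc N} {R T : ℝ} (hR : 0 ≤ R)
    (hz : patch Λ z' T = patch Λ z T) (hu : u ∈ locSet Λ x R) (hd : dist z u ≤ T - R) :
    u - z + z' ∈ locSet Λ x R := by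
  rw [dist_comm, dist_eq_norm] at hd
  have key : ∀ v : Euc N, ‖v‖ ≤ T → (v + z' ∈ Λ ↔ v + z ∈ Λ) := fun v hv => by
    have := congrArg (v ∈ ·) hz
    simpa [mem_patch_iff, hv] using this
  refine ⟨(key _ (by linarith)).2 (by simpa using hu.1), ?_⟩
  rw [← hu.2]
  ext v
  rw [mem_patch_iff, mem_patch_iff]
  refine and_congr_left fun hv => ?_
  have h1 : ‖v + (u - z)‖ ≤ T := (norm_add_le _ _).trans (by linarith)
  have h2 := key _ h1
  rwa [add_assoc, add_assoc, sub_add_cancel] at h2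

lemma locSet_subset_locSet {N : ℕ} {Λ : Set (Euc N)} {x z : Euc N} {R T : ℝ} (hR : 0 ≤ R)
    (hRT : R ≤ T) (hz : z ∈ locSet Λ x R) : locSet Λ z T ⊆ locSet Λ x R := fun z' hz' => by
  have := translate_mem_locSet hR hz'.2 hz (by simpa using hRT)
  simpa using this

/-- Nearest-neighbour distances in a locater set are determined by large enough patches. -/
lemma nearestDist_eq_of_mem_locSet {N : ℕ} {Λ : Set (Euc N)} {x z z' : Euc N} {R : ℝ}
    (hR : 0 ≤ R) (hL : ∀ A ⊆ locSet Λ x R, IsClosed A) (hnt : (locSet Λ x R).Nontrivial)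
    (hz' : z' ∈ locSet Λ z (R + nearestDist (locSet Λ x R) z)) :
    nearestDist (locSet Λ x R) z' = nearestDist (locSet Λ x R) z := by
  have hdist : ∀ u p q : Euc N, dist q (u - p + q) = dist p u := fun u p q => by
    rw [dist_comm p u, dist_comm q, dist_eq_norm, dist_eq_norm, add_sub_cancel_right]
  have h1 : nearestDist (locSet Λ x R) z' ≤ nearestDist (locSet Λ x R) z := by
    obtain ⟨u, hu, hne, hd⟩ := exists_dist_eq_nearestDist hL hnt z
    have hmem := translate_mem_locSet hR hz'.2 hu (by linarith)
    have hne' : u - z + z' ≠ z' := by simpa [sub_eq_zero] using hne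
    have := nearestDist_le_dist hmem hne'
    rwa [hdist, hd] at this
  refine h1.antisymm ?_
  obtain ⟨u, hu, hne, hd⟩ := exists_dist_eq_nearestDist hL hnt z'
  have hmem := translate_mem_locSet hR hz'.2.symm hu (by linarith)
  have hne' : u - z' + z ≠ z := by simpa [sub_eq_zero] using hne
  have := nearestDist_le_dist hmem hne'
  rwa [hdist, hd] at this

lemma ballVol_eq {N : ℕ} {r : ℝ} (hr : 0 ≤ r) : ballVol N r = r ^ N * ballVol N 1 := by
  have := Measure.addHaar_closedBall' (volume : Measure (Euc N)) 0 hr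
  rw [ballVol, ballVol, this, ENNReal.toReal_mul, ENNReal.toReal_ofReal (by positivity)]
  simp

lemma ballVol_one_pos (N : ℕ) : 0 < ballVol N 1 :=
  ENNReal.toReal_pos (Metric.measure_closedBall_pos volume _ one_pos).ne'
    measure_closedBall_lt_top.ne

lemma volume_cube {N : ℕ} (a : Euc N) {s : ℝ} (hs : 0 ≤ s) :
    volume (cube a s) = ENNReal.ofReal (s ^ N) := by
  have h : cube a s = (@WithLp.ofLp 2 (Fin N → ℝ)) ⁻¹' Set.Icc a.ofLp (fun i => a i + s) := by
    ext p
    simp [cube, Set.mem_Icc, Pi.le_def, forall_and]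
  rw [h, (PiLp.volume_preserving_ofLp (Fin N)).measure_preimage
    measurableSet_Icc.nullMeasurableSet, Real.volume_Icc_pi]
  simp [ENNReal.ofReal_pow hs]

/-- Disjoint balls inside a cube have total volume at most that of the cube. -/
lemma sum_pow_mul_ballVol_le {N : ℕ} (hN : 0 < N) {ι : Type*} (F : Finset ι) (c : ι → Euc N)
    (r : ι → ℝ) (hr : ∀ i ∈ F, 0 ≤ r i)
    (hdisj : ∀ i ∈ F, ∀ j ∈ F, i ≠ j → r i + r j ≤ dist (c i) (c j))
    {a : Euc N} {s : ℝ} (hs : 0 ≤ s) (hsub : ∀ i ∈ F, Metric.ball (c i) (r i) ⊆ cube a s) :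
    ∑ i ∈ F, r i ^ N * ballVol N 1 ≤ s ^ N := by
  have : Nonempty (Fin N) := ⟨⟨0, hN⟩⟩
  have h1 : ∑ i ∈ F, volume (Metric.ball (c i) (r i)) ≤ volume (cube a s) := by
    rw [← measure_biUnion_finset (fun i hi j hj hij =>
      Metric.ball_disjoint_ball (hdisj i hi j hj hij)) fun i _ => Metric.isOpen_ball.measurableSet]
    exact measure_mono (Set.iUnion₂_subset hsub)
  have h2 : ∀ i ∈ F, volume (Metric.ball (c i) (r i)) =
      ENNReal.ofReal (r i ^ N * ballVol N 1) := fun i hi => by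
    rw [Measure.addHaar_ball _ _ (hr i hi), ENNReal.ofReal_mul (pow_nonneg (hr i hi) N), ballVol,
      ENNReal.ofReal_toReal measure_closedBall_lt_top.ne,
      Measure.addHaar_unitClosedBall_eq_addHaar_unitBall]
    simp
  rw [Finset.sum_congr rfl h2, volume_cube a hs, ← ENNReal.ofReal_sum_of_nonneg] at h1
  · exact (ENNReal.ofReal_le_ofReal_iff (by positivity)).1 h1
  · exact fun i hi => mul_nonneg (pow_nonneg (hr i hi) N) (ballVol_one_pos N).le

/-- Positivity of weights yields uniformly many copies of a pattern in all large cubes. -/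
lemma PW.le_countP {N : ℕ} {Λ : Set (Euc N)} (h : PW Λ) {x : Euc N} (hx : x ∈ Λ) {R : ℝ}
    (hR : 1 ≤ R) : ∀ᶠ s : ℝ in atTop, ∀ a : Euc N,
      wPW Λ / 2 * s ^ N ≤ countP Λ x R (cube a s) * (R ^ N * ballVol N 1) := by
  have hle : wPW Λ ≤ nu Λ x R := by
    refine csInf_le ?_ ⟨x, hx, R, hR, rfl⟩
    by_contra hb
    have := Real.sInf_of_not_bddBelow hb
    exact h.ne' this
  have hlt : wPW Λ / 2 < nu Λ x R := (half_lt_self h).trans_le hle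
  have hne : {v : ℝ | ∀ᶠ cs in cubeFilter N, v ≤ (countP Λ x R (cube cs.1 cs.2) : ℝ) *
      ballVol N R / cs.2 ^ N}.Nonempty := by
    by_contra hemp
    rw [Set.not_nonempty_iff_eq_empty] at hemp
    have : nu Λ x R = 0 := by rw [nu, Filter.liminf_eq, hemp, Real.sSup_empty]
    have h' : 0 < wPW Λ := h
    linarith
  rw [nu, Filter.liminf_eq] at hlt
  obtain ⟨v, hv, hwv⟩ := exists_lt_of_lt_csSup hne hlt
  have hv' : ∀ᶠ s : ℝ in atTop, ∀ a : Euc N,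
      v ≤ (countP Λ x R (cube a s) : ℝ) * ballVol N R / s ^ N := by
    have h3 : ∀ᶠ cs in cubeFilter N, v ≤ (countP Λ x R (cube cs.1 cs.2) : ℝ) *
      ballVol N R / cs.2 ^ N := hv
    rw [cubeFilter, Filter.eventually_prod_iff] at h3
    obtain ⟨p, hp, q, hq, hpq⟩ := h3
    rw [Filter.eventually_top] at hp
    exact hq.mono fun s hs a => hpq (hp a) hs
  filter_upwards [hv', eventually_gt_atTop 0] with s hs hs0 a
  have h4 := hwv.le.trans (hs a)
  rw [le_div_iff₀ (by positivity), ballVol_eq (by linarith)] at h4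
  exact h4

lemma PW.nontrivial_locSet {N : ℕ} (hN : 0 < N) {Λ : Set (Euc N)} (h : PW Λ) {x : Euc N}
    (hx : x ∈ Λ) {R : ℝ} (hR : 1 ≤ R) : (locSet Λ x R).Nontrivial := by
  by_contra hsub
  rw [Set.not_nontrivial_iff] at hsub
  have hv := ballVol_one_pos N
  have h' : 0 < wPW Λ := h
  have htend : Tendsto (fun s : ℝ => wPW Λ / 2 * s ^ N) atTop atTop :=
    (tendsto_pow_atTop hN.ne').const_mul_atTop (by positivity)
  obtain ⟨s, hs, hgt⟩ := ((h.le_countP hx hR).and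
    (htend.eventually_gt_atTop (R ^ N * ballVol N 1))).exists
  have h1 : countP Λ x R (cube 0 s) ≤ 1 :=
    (Set.ncard_le_one (hsub.anti (Set.sep_subset _ _)).finite).2 fun u hu v hv =>
      hsub hu.1 hv.1
  have h2 : (countP Λ x R (cube 0 s) : ℝ) ≤ 1 := by exact_mod_cast h1
  have h3 := hs 0
  have h4 : (countP Λ x R (cube 0 s) : ℝ) * (R ^ N * ballVol N 1) ≤ 1 * (R ^ N * ballVol N 1) := by
    gcongr
  linarith

lemma half_nearestDist_add_half_nearestDist_le_dist {N : ℕ} {L : Set (Euc N)} {u v : Euc N} (hu : u ∈ L)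
    (hv : v ∈ L) (h : u ≠ v) :
    nearestDist L u / 2 + nearestDist L v / 2 ≤ dist u v := by
  have h1 := nearestDist_le_dist hv h.symm
  have h2 := nearestDist_le_dist hu h
  rw [dist_comm] at h2
  linarith

/-- In a set of positive density some nearest-neighbour distance is small. -/
lemma PW.exists_nearestDist_le {N : ℕ} (hN : 0 < N) {Λ : Set (Euc N)} (h : PW Λ) {x : Euc N}
    (hx : x ∈ Λ) {R : ℝ} (hR : 1 ≤ R) :
    ∃ z ∈ locSet Λ x R, nearestDist (locSet Λ x R) z ≤ (4 + 8 / wPW Λ) * R := by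
  by_contra! hcon
  have hw : 0 < wPW Λ := h
  have hv := ballVol_one_pos N
  set L := locSet Λ x R
  set m := (4 + 8 / wPW Λ) * R with hm
  have hm0 : 0 < m := by positivity
  obtain ⟨s, hs, hsm⟩ := ((h.le_countP hx hR).and (eventually_ge_atTop m)).exists
  have hs0 : 0 < s := hm0.trans_le hsm
  set a : Euc N := 0
  have hcnt := hs a
  have hfin : (locIn Λ x R (cube a s)).Finite := by
    refine Set.finite_of_ncard_pos (Nat.pos_of_ne_zero fun h0 => ?_)
    rw [countP, h0] at hcnt
    have : 0 < wPW Λ / 2 * s ^ N := by positivity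
    simp at hcnt
    linarith
  set b : Euc N := WithLp.toLp 2 fun _ => -(m / 2)
  have hsum := sum_pow_mul_ballVol_le hN hfin.toFinset id (fun _ => m / 2)
    (fun _ _ => by positivity) (fun u hu v hv huv => by
      have hu' : u ∈ L := ((hfin.mem_toFinset).1 hu).1
      have hv' : v ∈ L := ((hfin.mem_toFinset).1 hv).1
      have := half_nearestDist_add_half_nearestDist_le_dist hu' hv' huv
      have := hcon u hu'
      have := hcon v hv'
      simp only [id]
      linarith) (a := b) (s := s + m) (by positivity) (fun u hu p hp i => by
      have hu' := ((hfin.mem_toFinset).1 hu).2 (Metric.mem_closedBall_self (by linarith)) i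
      have h1 : |p i - u i| ≤ m / 2 := by
        have h2 := PiLp.norm_apply_le (p - u) i
        rw [← dist_eq_norm] at h2
        exact h2.trans (Metric.mem_ball.1 hp).le
      rw [abs_le] at h1
      simp only [a, PiLp.zero_apply] at hu'
      simp only [b]
      constructor <;> linarith [h1.1, h1.2, hu'.1, hu'.2])
  rw [Finset.sum_const, nsmul_eq_mul, ← Set.ncard_eq_toFinset_card _ hfin] at hsum
  change (countP Λ x R (cube a s) : ℝ) * _ ≤ _ at hsum
  set n : ℝ := (countP Λ x R (cube a s) : ℝ)
  have h5 : (s + m) ^ N ≤ 2 ^ N * s ^ N := by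
    rw [← mul_pow]
    gcongr
    linarith
  have hRne : R ≠ 0 := by positivity
  have h6 : (wPW Λ / 2) * (m / (4 * R)) ^ N * (2 ^ N * s ^ N) ≤ 1 * (2 ^ N * s ^ N) := by
    calc (wPW Λ / 2) * (m / (4 * R)) ^ N * (2 ^ N * s ^ N)
        = (wPW Λ / 2 * s ^ N) * ((m / 2) ^ N / R ^ N) := by
          rw [← div_pow, mul_comm (2 ^ N) (s ^ N), mul_assoc, mul_left_comm _ (s ^ N),
            ← mul_pow, mul_assoc]
          congr 3
          field_simp
          norm_num
      _ ≤ (n * (R ^ N * ballVol N 1)) * ((m / 2) ^ N / R ^ N) := by gcongr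
      _ = n * ((m / 2) ^ N * ballVol N 1) := by field_simp
      _ ≤ 1 * (2 ^ N * s ^ N) := by linarith
  have h7 := le_of_mul_le_mul_right h6 (by positivity)
  have h8 : m / (4 * R) = 1 + 2 / wPW Λ := by
    rw [hm]
    field_simp
    ring
  have h9 : 1 + 2 / wPW Λ ≤ (1 + 2 / wPW Λ) ^ N :=
    le_self_pow₀ (by linarith [show 0 < 2 / wPW Λ by positivity]) hN.ne'
  rw [h8] at h7
  have h10 : wPW Λ / 2 * (1 + 2 / wPW Λ) ≤ 1 := le_trans (by gcongr) h7
  have h11 : wPW Λ / 2 * (1 + 2 / wPW Λ) = wPW Λ / 2 + 1 := by field_simp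
  linarith

/-- Only boundedly many different nearest-neighbour distances `≥ R` occur in a locater set. -/
lemma PW.card_nearestDist_le {N : ℕ} (hN : 0 < N) {Λ : Set (Euc N)} (h : PW Λ)
    (hΛ : UniformlyDiscrete Λ) {x : Euc N} (hx : x ∈ Λ) {R : ℝ} (hR : 1 ≤ R)
    {k : ℕ} (z : Fin k → Euc N) (hz : ∀ j, z j ∈ locSet Λ x R)
    (hzR : ∀ j, R ≤ nearestDist (locSet Λ x R) (z j))
    (hinj : Function.Injective fun j => nearestDist (locSet Λ x R) (z j)) :
    (k : ℝ) ≤ 2 * 4 ^ N / wPW Λ := by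
  have hw : 0 < wPW Λ := h
  have hv := ballVol_one_pos N
  have hR0 : 0 ≤ R := by linarith
  set L := locSet Λ x R
  have hL : ∀ A ⊆ L, IsClosed A := fun A hA =>
    hΛ.isClosed_of_subset (hA.trans (Set.sep_subset _ _))
  have hnt : L.Nontrivial := h.nontrivial_locSet hN hx hR
  set d : Fin k → ℝ := fun j => nearestDist L (z j)
  have hd : ∀ j, R ≤ d j := hzR
  have hev := Filter.eventually_all.2 fun j =>
    h.le_countP (x := z j) (R := R + d j) (hz j).1 (by linarith [hd j])
  obtain ⟨s, hs, hs0⟩ := (hev.and (eventually_gt_atTop (0 : ℝ))).exists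
  set Q : Set (Euc N) := cube 0 s
  have hfin : ∀ j, (locIn Λ (z j) (R + d j) Q).Finite := fun j => by
    refine Set.finite_of_ncard_pos (Nat.pos_of_ne_zero fun h0 => ?_)
    have hcnt := hs j 0
    rw [countP, h0] at hcnt
    have : 0 < wPW Λ / 2 * s ^ N := by positivity
    simp at hcnt
    linarith
  have hmem : ∀ j, ∀ u ∈ locIn Λ (z j) (R + d j) Q, u ∈ L ∧ nearestDist L u = d j :=
    fun j u hu => ⟨locSet_subset_locSet hR0 (by linarith [hd j]) (hz j) hu.1,
      nearestDist_eq_of_mem_locSet hR0 hL hnt hu.1⟩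
  have hsum := sum_pow_mul_ballVol_le hN
    (Finset.univ.sigma fun j => (hfin j).toFinset) (fun p => p.2) (fun p => d p.1 / 2)
    (fun p _ => by linarith [hd p.1])
    (by
      rintro ⟨i, u⟩ hu ⟨j, v⟩ hv hne
      simp only [Finset.mem_sigma, Finset.mem_univ, true_and, Set.Finite.mem_toFinset] at hu hv
      obtain ⟨huL, hud⟩ := hmem i u hu
      obtain ⟨hvL, hvd⟩ := hmem j v hv
      have huv : u ≠ v := by
        rintro rfl
        have hij : i = j := hinj (hud.symm.trans hvd)
        subst hij
        exact hne rfl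
      have := half_nearestDist_add_half_nearestDist_le_dist huL hvL huv
      rwa [hud, hvd] at this)
    (a := 0) (s := s) hs0.le
    (by
      rintro ⟨i, u⟩ hu
      simp only [Finset.mem_sigma, Finset.mem_univ, true_and, Set.Finite.mem_toFinset] at hu
      refine (Metric.ball_subset_closedBall.trans (Metric.closedBall_subset_closedBall ?_)).trans
        hu.2
      linarith [hd i])
  rw [Finset.sum_sigma] at hsum
  have hterm : ∀ j, wPW Λ / 2 * s ^ N / 4 ^ N ≤
      ∑ _u ∈ (hfin j).toFinset, (d j / 2) ^ N * ballVol N 1 := fun j => by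
    rw [Finset.sum_const, nsmul_eq_mul, ← Set.ncard_eq_toFinset_card _ (hfin j),
      div_le_iff₀ (by positivity)]
    refine (hs j 0).trans ?_
    change (countP Λ (z j) (R + d j) Q : ℝ) * _ ≤ (countP Λ (z j) (R + d j) Q : ℝ) * _ * _
    have h1 : (R + d j) ^ N ≤ (d j / 2) ^ N * 4 ^ N := by
      rw [← mul_pow]
      have := hd j
      exact pow_le_pow_left₀ (by linarith) (by linarith) N
    calc (countP Λ (z j) (R + d j) Q : ℝ) * ((R + d j) ^ N * ballVol N 1)
        ≤ (countP Λ (z j) (R + d j) Q : ℝ) * ((d j / 2) ^ N * 4 ^ N * ballVol N 1) := by gcongr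
      _ = _ := by ring
  have htot : (k : ℝ) * (wPW Λ / 2 * s ^ N / 4 ^ N) ≤ s ^ N := by
    refine le_trans ?_ hsum
    have := Finset.sum_le_sum fun j (_ : j ∈ Finset.univ) => hterm j
    simpa using this
  have hsN : 0 < s ^ N := by positivity
  rw [le_div_iff₀ hw]
  have h3 : (k : ℝ) * wPW Λ * s ^ N ≤ 2 * 4 ^ N * s ^ N := by
    have h4 : (k : ℝ) * (wPW Λ / 2 * s ^ N / 4 ^ N) * (2 * 4 ^ N) = (k : ℝ) * wPW Λ * s ^ N := by
      field_simp
    rw [← h4]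
    calc _ ≤ s ^ N * (2 * 4 ^ N) := by gcongr
      _ = _ := by ring
  exact le_of_mul_le_mul_right h3 hsN

/-- A set whose Voronoi cells are controlled by nearest-neighbour distances `≤ m` has covering
radius at most `D * m`. -/
lemma rCov_le_of_nearestDist_le {N : ℕ} {L : Set (Euc N)} (hL : IsClosed L) (hne : L.Nonempty)
    {D m : ℝ} (hD : 0 ≤ D)
    (hvor : ∀ y ∈ L, ∀ q ∈ voronoiCell L y, dist q y ≤ D * nearestDist L y)
    (hm : ∀ y ∈ L, nearestDist L y ≤ m) : rCov L ≤ ENNReal.ofReal (D * m) := by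
  refine iSup_le fun p => ?_
  obtain ⟨y, hy, hpy⟩ := hL.exists_infDist_eq_dist hne p
  refine (Metric.infEDist_le_edist_of_mem hy).trans ?_
  rw [edist_dist]
  refine ENNReal.ofReal_le_ofReal ((hvor y hy p fun v hv => ?_).trans ?_)
  · rw [← hpy]
    exact Metric.infDist_le_dist_of_mem hv
  · exact mul_le_mul_of_nonneg_left (hm y hy) hD

/-- Under (PW) and (U) covering radii of locater sets grow at most linearly. -/
lemma exists_rCov_locSet_le {N : ℕ} (hN : 0 < N) {Λ : Set (Euc N)} (hΛ : UniformlyDiscrete Λ)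
    (h : PW Λ) (hU : URW Λ) :
    ∃ K : ℝ, ∀ x ∈ Λ, ∀ R : ℝ, 1 ≤ R → rCov (locSet Λ x R) ≤ ENNReal.ofReal (K * R) := by
  have hw : 0 < wPW Λ := h
  obtain ⟨D, hD1, hD⟩ : ∃ D : ℝ, 1 ≤ D ∧ ∀ x ∈ Λ, ∀ R : ℝ, 0 < R →
      setDistortion (locSet Λ x R) ≤ ENNReal.ofReal D := by
    obtain ⟨B, hB⟩ := ENNReal.lt_iff_exists_nnreal_btwn.1 hU
    refine ⟨max 1 B, le_max_left _ _, fun x hx R hR => ?_⟩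
    refine le_trans ?_ (ENNReal.ofReal_le_ofReal (le_max_right 1 (B : ℝ)))
    rw [ENNReal.ofReal_coe_nnreal]
    refine le_trans ?_ hB.1.le
    exact le_iSup_of_le x <| le_iSup_of_le hx <| le_iSup_of_le R <|
      le_iSup (fun _ : 0 < R => setDistortion (locSet Λ x R)) hR
  set C := 4 + 8 / wPW Λ
  have hC1 : 1 ≤ C := by
    have : 0 < 8 / wPW Λ := by positivity
    linarith
  set k := ⌊2 * 4 ^ N / wPW Λ⌋₊ + 1 with hk
  refine ⟨D * (C * (2 * D) ^ k), fun x hx R hR => ?_⟩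
  set L := locSet Λ x R
  have hL : ∀ A ⊆ L, IsClosed A := fun A hA =>
    hΛ.isClosed_of_subset (hA.trans (Set.sep_subset _ _))
  have hnt : L.Nontrivial := h.nontrivial_locSet hN hx hR
  have hvor : ∀ y ∈ L, ∀ q ∈ voronoiCell L y, dist q y ≤ D * nearestDist L y :=
    fun y hy q hq => dist_le_of_mem_voronoiCell hL hnt (by linarith) (hD x hx R (by linarith)) hy hq
  rw [mul_assoc]
  refine rCov_le_of_nearestDist_le (hL L subset_rfl) hnt.nonempty (by linarith) hvor fun y hy => ?_
  by_contra! hlarge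
  obtain ⟨y₀, hy₀, hsmall⟩ := h.exists_nearestDist_le hN hx hR
  have hE : 1 ≤ 2 * D := by linarith
  have hex : ∀ j : Fin k, ∃ z ∈ L, C * R * (2 * D) ^ (j : ℕ) < nearestDist L z ∧
      nearestDist L z ≤ C * R * (2 * D) ^ ((j : ℕ) + 1) := fun j => by
    obtain ⟨z, hz, hz1, hz2⟩ := exists_nearestDist_between hL hvor hD1
      (a := C * R * (2 * D) ^ (j : ℕ)) hy₀ hy
      (hsmall.trans (le_mul_of_one_le_right (by positivity) (one_le_pow₀ hE)))
      (by
        refine lt_of_le_of_lt ?_ hlarge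
        calc 2 * D * (C * R * (2 * D) ^ (j : ℕ)) = C * (2 * D) ^ ((j : ℕ) + 1) * R := by ring
          _ ≤ C * (2 * D) ^ k * R := by
            gcongr
            exact j.2)
    exact ⟨z, hz, hz1, hz2.trans_eq (by ring)⟩
  choose z hzL hz1 hz2 using hex
  have hmono : StrictMono fun j => nearestDist L (z j) := fun i j hij => by
    refine (hz2 i).trans_lt (lt_of_le_of_lt ?_ (hz1 j))
    gcongr
    exact hij
  have hcard := h.card_nearestDist_le hN hΛ hx hR z hzL (fun j => by
    refine le_trans ?_ (hz1 j).le
    rw [mul_right_comm]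
    exact le_mul_of_one_le_left (by linarith)
      (one_le_mul_of_one_le_of_one_le hC1 (one_le_pow₀ hE))) hmono.injective
  have := Nat.lt_floor_add_one (2 * 4 ^ N / wPW Λ)
  rw [hk] at hcard
  push_cast at hcard
  linarith

/-- A non-periodic Delone set satisfying (PW) and (U) is linearly
repetitive; more precisely there is a constant `K` with `r_cov(L_P) ≤ K · r(P)`
for every ball pattern `P` of radius `r(P) ≥ 3`. -/
theorem pw_u_implies_lr {N : ℕ} (hN : 0 < N) (Λ : Set (Euc N))
    (hΛ : IsDelone Λ) (hnp : NonPeriodic Λ) (hPW : PW Λ) (hU : URW Λ) :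
    LR Λ ∧ ∃ K : ℝ, ∀ x ∈ Λ, ∀ R : ℝ, 3 ≤ R →
      rCov (locSet Λ x R) ≤ ENNReal.ofReal (K * R) := by
  obtain ⟨K, hK⟩ := exists_rCov_locSet_le hN hΛ.1 hPW hU
  refine ⟨?_, K, fun x hx R hR => hK x hx R (by linarith)⟩
  refine lt_of_le_of_lt ?_ (ENNReal.ofReal_lt_top (r := K))
  refine iSup₂_le fun x hx => iSup₂_le fun R hR => ?_
  have hR0 : 0 < R := by linarith
  refine ENNReal.div_le_of_le_mul ?_
  rw [← ENNReal.ofReal_mul' hR0.le]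
  exact hK x hx R hR
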